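/- Let n ≥ 3 and let (J_cyc, a) be a partial n×n matrix over a field 𝔽 on the cycle pattern with all prescribed entries a_{ij} nonzero, and suppose a_{12}a_{23}⋯a_{n−1,n}a_{n1} ≠ a_{11}a_{22}⋯a_{n−1,n−1}a_{nn}. Then tmr(J_cyc,a) = 1, fmr(J_cyc,a) = n/(n−1), and mr(J_cyc,a) = 2. -/

import Mathlib

open Matrix

variable {F : Type*} [Field F] {m n : Type*} [Fintype m] [Fintype n]

/-- `B` is a completion of the partial matrix `(J, a)`: it agrees with the
prescribed entries on the pattern `J`. -/
def Completes (J : Set (m × n)) (a : m → n → F) (B : Matrix m n F) : Prop :=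
  ∀ p ∈ J, B p.1 p.2 = a p.1 p.2

/-- Minimal rank of the partial matrix `(J, a)`: the minimum of the ranks of
all completions. -/
noncomputable def pmr (J : Set (m × n)) (a : m → n → F) : ℕ :=
  sInf {r : ℕ | ∃ B : Matrix m n F, Completes J a B ∧ B.rank = r}

/-- A pattern `T` is triangular if whenever `(i,j) ∈ T` and `(k,l) ∈ T`,
then `(i,l) ∈ T` or `(k,j) ∈ T`. -/
def Triangular (T : Set (m × n)) : Prop :=
  ∀ p ∈ T, ∀ q ∈ T, (p.1, q.2) ∈ T ∨ (q.1, p.2) ∈ T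

/-- Triangular minimal rank: the maximum of `pmr` over triangular
subpatterns of `J`. -/
noncomputable def ptmr (J : Set (m × n)) (a : m → n → F) : ℕ :=
  sSup {r : ℕ | ∃ T ⊆ J, Triangular T ∧ pmr T a = r}

/-- Pattern of the tensor `(J,a) ⊗ I_b`. -/
def TensorJ (J : Set (m × n)) (b : ℕ) : Set ((m × Fin b) × (n × Fin b)) :=
  {p | (p.1.1, p.2.1) ∈ J}

/-- Entries of the tensor `(J,a) ⊗ I_b`: `a i j` on the diagonal of each
`b × b` block, `0` off the diagonal. -/
def TensorA (a : m → n → F) (b : ℕ) : m × Fin b → n × Fin b → F :=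
  fun ip jq => if ip.2 = jq.2 then a ip.1 jq.1 else 0

/-- `b`-fold minimal rank `mr_b(J,a) = mr((J,a) ⊗ I_b)`. -/
noncomputable def pmrb (J : Set (m × n)) (a : m → n → F) (b : ℕ) : ℕ :=
  pmr (TensorJ J b) (TensorA a b)

/-- Fractional minimal rank: `inf_{b ≥ 1} mr_b(J,a) / b`. -/
noncomputable def pfmr (J : Set (m × n)) (a : m → n → F) : ℝ :=
  ⨅ b : ℕ+, (pmrb J a b : ℝ) / (b : ℝ)

/-- The cycle pattern on `{1,…,n} × {1,…,n}`: positions `(i,i)` for all `i`,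
`(i, i+1)` for `i ≤ n−1`, and `(n, 1)` (encoded via addition mod `n`). -/
def CycleJ (n : ℕ) [NeZero n] : Set (Fin n × Fin n) :=
  {p | p.2 = p.1 ∨ p.2 = p.1 + 1}

omit [Fintype m] in
/-- A matrix over a field factors through a space of dimension its rank. -/
lemma Matrix.exists_mul_eq_of_rank [DecidableEq n] (B : Matrix m n F) :
    ∃ (U : Matrix m (Fin B.rank) F) (V : Matrix (Fin B.rank) n F), U * V = B := by
  let b : Module.Basis (Fin B.rank) F (LinearMap.range B.mulVecLin) :=
    Module.finBasisOfFinrankEq F _ rfl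
  let c : n → LinearMap.range B.mulVecLin := fun j => ⟨B.mulVecLin (Pi.single j 1), LinearMap.mem_range_self _ _⟩
  refine ⟨of fun i s => (b s : m → F) i, of fun s j => b.repr (c j) s, ?_⟩
  ext i j
  have h : ((∑ s, b.repr (c j) s • b s : LinearMap.range B.mulVecLin) : m → F) i = B i j := by
    rw [b.sum_repr]
    simp [c]
  rw [← h]
  simp only [AddSubmonoidClass.coe_finsetSum, Finset.sum_apply, Submodule.coe_smul,
    Pi.smul_apply, smul_eq_mul, Matrix.mul_apply, of_apply, mul_comm]

omit [Fintype m] in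
lemma Matrix.rank_add_le (A B : Matrix m n F) : (A + B).rank ≤ A.rank + B.rank := by
  unfold Matrix.rank
  refine (Submodule.finrank_mono ?_).trans (Submodule.finrank_add_le_finrank_add_finrank _ _)
  rw [Matrix.mulVecLin_add]
  exact LinearMap.range_add_le _ _

omit [Fintype m] in
lemma Matrix.rank_sum_le {ι : Type*} (s : Finset ι) (A : ι → Matrix m n F) :
    (∑ i ∈ s, A i).rank ≤ ∑ i ∈ s, (A i).rank := by
  classical
  induction s using Finset.induction_on with
  | empty => simp
  | insert i s hi ih =>
    rw [Finset.sum_insert hi, Finset.sum_insert hi]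
    exact (Matrix.rank_add_le _ _).trans (by gcongr)

lemma Matrix.rank_smul_one {β : Type*} [Fintype β] [DecidableEq β] {c : F} (hc : c ≠ 0) :
    (c • (1 : Matrix β β F)).rank = Fintype.card β := by
  rw [Matrix.rank_smul_of_mem_nonZeroDivisors _ (mem_nonZeroDivisors_of_ne_zero hc),
    Matrix.rank_one]

omit [Fintype m] in
lemma pmr_le_of_completes {J : Set (m × n)} {a : m → n → F} {B : Matrix m n F}
    (hB : Completes J a B) : pmr J a ≤ B.rank :=
  Nat.sInf_le ⟨B, hB, rfl⟩

omit [Fintype m] in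
lemma exists_completes_rank_eq_pmr (J : Set (m × n)) (a : m → n → F) :
    ∃ B : Matrix m n F, Completes J a B ∧ B.rank = pmr J a :=
  Nat.sInf_mem (s := {r : ℕ | ∃ B : Matrix m n F, Completes J a B ∧ B.rank = r})
    ⟨_, of a, fun _ _ => rfl, rfl⟩

/-- A cyclic first-order recurrence has a nonvanishing solution once a single step is dropped. -/
lemma exists_cycle_potential {n : ℕ} [NeZero n] (x y : Fin n → F)
    (hx : ∀ i, x i ≠ 0) (hy : ∀ i, y i ≠ 0) (k : Fin n) :
    ∃ w : Fin n → F, (∀ i, w i ≠ 0) ∧ ∀ i, i ≠ k → w (i + 1) * x i = y i * w i := by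
  obtain ⟨m, rfl⟩ : ∃ m, n = m + 1 := Nat.exists_eq_succ_of_ne_zero (NeZero.ne n)
  let g : ℕ → F := fun t => y (k + 1 + Fin.ofNat (m + 1) t) / x (k + 1 + Fin.ofNat (m + 1) t)
  refine ⟨fun i => ∏ t ∈ Finset.range (i - (k + 1)).val, g t, fun i => ?_, fun i hi => ?_⟩
  · exact Finset.prod_ne_zero_iff.2 fun t _ => div_ne_zero (hy _) (hx _)
  · have h1 : i + 1 - (k + 1) = (i - (k + 1)) + 1 := by abel
    have h2 : i - (k + 1) ≠ Fin.last m := by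
      intro h
      apply hi
      have h3 : i - (k + 1) + 1 = 0 := by rw [h]; exact Fin.last_add_one m
      have h4 : i - (k + 1) + 1 = i - k := by abel
      rw [h4] at h3
      exact sub_eq_zero.1 h3
    have h5 : k + 1 + Fin.ofNat (m + 1) (i - (k + 1)).val = i := by
      rw [Fin.ofNat_val_eq_self]
      abel
    have h6 : (i + 1 - (k + 1)).val = (i - (k + 1)).val + 1 := by
      rw [h1, Fin.val_add_one, if_neg h2]
    simp only [h6, Finset.prod_range_succ]
    have h7 : g (i - (k + 1)).val = y i / x i := by simp only [g, h5]
    rw [h7]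
    field_simp [hx i]

/-- Lower bound for the inner dimension of a factorisation whose diagonal and superdiagonal
(cyclically) blocks are scalar. -/
lemma card_mul_le_of_cycle_factorization {n : ℕ} [NeZero n] (a : Fin n → Fin n → F)
    (hd : ∀ i, a i i ≠ 0) (hs : ∀ i, a i (i + 1) ≠ 0)
    (hne : ∏ i : Fin n, a i (i + 1) ≠ ∏ i : Fin n, a i i)
    {β ρ : Type*} [Fintype β] [DecidableEq β] [Fintype ρ]
    (U : Fin n → Matrix β ρ F) (V : Fin n → Matrix ρ β F)
    (h0 : ∀ i, U i * V i = a i i • 1) (h1 : ∀ i, U i * V (i + 1) = a i (i + 1) • 1) :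
    n * Fintype.card β ≤ (n - 1) * Fintype.card ρ := by
  obtain ⟨w, hw, hw'⟩ := exists_cycle_potential (fun i => a i i) (fun i => a i (i + 1)) hd hs 0
  let X : Fin n → Matrix ρ β F := fun i => (w (i + 1))⁻¹ • V (i + 1) - (w i)⁻¹ • V i
  have hUX : ∀ i, U i * X i = (a i (i + 1) / w (i + 1) - a i i / w i) • 1 := by
    intro i
    simp only [X, Matrix.mul_sub, Matrix.mul_smul, h0, h1, smul_smul, sub_smul, div_eq_inv_mul]
  have hX0 : ∀ i, i ≠ 0 → U i * X i = 0 := by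
    intro i hi
    rw [hUX, sub_eq_zero.2, zero_smul]
    rw [div_eq_div_iff (hw _) (hw _), ← hw' i hi, mul_comm]
  have hrU : ∀ i, Fintype.card β ≤ (U i).rank := by
    intro i
    rw [← Matrix.rank_smul_one (β := β) (hd i), ← h0 i]
    exact Matrix.rank_mul_le_left _ _
  have hrX : ∀ i, i ≠ 0 → (X i).rank + Fintype.card β ≤ Fintype.card ρ := by
    intro i hi
    have := Matrix.rank_add_rank_le_card_of_mul_eq_zero (hX0 i hi)
    have := hrU i
    omega
  have hsum : ∑ i, X i = 0 := by
    simp only [X, Finset.sum_sub_distrib]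
    rw [sub_eq_zero]
    exact Fintype.sum_equiv (Equiv.addRight (1 : Fin n)) _ _ fun i => rfl
  have hc : a 0 (0 + 1) / w (0 + 1) - a 0 0 / w 0 ≠ 0 := by
    intro h
    apply hne
    rw [sub_eq_zero, div_eq_div_iff (hw _) (hw _)] at h
    have hall : ∀ i, w (i + 1) * a i i = a i (i + 1) * w i := by
      intro i
      by_cases hi : i = 0
      · subst hi; rw [h, mul_comm]
      · exact hw' i hi
    have hp : (∏ i, w (i + 1)) * ∏ i, a i i = (∏ i, a i (i + 1)) * ∏ i, w i := by
      simp only [← Finset.prod_mul_distrib, hall]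
    have he : ∏ i, w (i + 1) = ∏ i, w i :=
      Fintype.prod_equiv (Equiv.addRight (1 : Fin n)) _ _ fun i => rfl
    rw [he, mul_comm] at hp
    exact (mul_right_cancel₀ (Finset.prod_ne_zero_iff.2 fun i _ => hw i) hp).symm
  have hkey : Fintype.card β ≤ ∑ i ∈ Finset.univ.erase (0 : Fin n), (X i).rank := by
    have hX : X 0 = ∑ i ∈ Finset.univ.erase (0 : Fin n), -X i := by
      rw [Finset.sum_neg_distrib, eq_neg_iff_add_eq_zero,
        Finset.add_sum_erase _ _ (Finset.mem_univ _), hsum]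
    calc Fintype.card β = (U 0 * X 0).rank := by rw [hUX, Matrix.rank_smul_one hc]
      _ ≤ (X 0).rank := Matrix.rank_mul_le_right _ _
      _ ≤ ∑ i ∈ Finset.univ.erase (0 : Fin n), (-X i).rank := by
        rw [hX]; exact Matrix.rank_sum_le _ _
      _ = _ := by
        refine Finset.sum_congr rfl fun i _ => ?_
        rw [← neg_one_smul F (X i), Matrix.rank_smul_of_mem_nonZeroDivisors _
          (mem_nonZeroDivisors_of_ne_zero (neg_ne_zero.2 one_ne_zero))]
  have hle : ∑ i ∈ Finset.univ.erase (0 : Fin n), ((X i).rank + Fintype.card β) ≤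
      ∑ i ∈ Finset.univ.erase (0 : Fin n), Fintype.card ρ :=
    Finset.sum_le_sum fun i hi => hrX i (Finset.ne_of_mem_erase hi)
  rw [Finset.sum_add_distrib, Finset.sum_const, Finset.sum_const,
    Finset.card_erase_of_mem (Finset.mem_univ _), Finset.card_univ, Fintype.card_fin,
    smul_eq_mul, smul_eq_mul] at hle
  obtain ⟨m, rfl⟩ : ∃ m, n = m + 1 := Nat.exists_eq_succ_of_ne_zero (NeZero.ne n)
  simp only [Nat.add_sub_cancel] at hle ⊢
  rw [Nat.add_mul]
  omega

section Cycle

variable {n : ℕ} [NeZero n] {a : Fin n → Fin n → F}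

lemma cycleJ_diag_mem (i : Fin n) : (i, i) ∈ CycleJ n := Or.inl rfl

lemma cycleJ_succ_mem (i : Fin n) : (i, i + 1) ∈ CycleJ n := Or.inr rfl

lemma mul_le_pmrb_cycleJ (hnz : ∀ p ∈ CycleJ n, a p.1 p.2 ≠ 0)
    (hne : ∏ i : Fin n, a i (i + 1) ≠ ∏ i : Fin n, a i i) (b : ℕ) :
    n * b ≤ (n - 1) * pmrb (CycleJ n) a b := by
  obtain ⟨B, hB, hr⟩ := exists_completes_rank_eq_pmr (TensorJ (CycleJ n) b) (TensorA a b)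
  obtain ⟨U, V, hUV⟩ := B.exists_mul_eq_of_rank
  have hblock : ∀ i j, (i, j) ∈ CycleJ n →
      (of fun p s => U (i, p) s : Matrix (Fin b) _ F) * (of fun s q => V s (j, q)) =
        a i j • (1 : Matrix (Fin b) (Fin b) F) := by
    intro i j hij
    ext p q
    have h1 : B (i, p) (j, q) = TensorA a b (i, p) (j, q) := hB ((i, p), (j, q)) hij
    rw [← hUV] at h1
    simpa [Matrix.mul_apply, TensorA, Matrix.one_apply] using h1
  have := card_mul_le_of_cycle_factorization a (fun i => hnz _ (cycleJ_diag_mem i))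
    (fun i => hnz _ (cycleJ_succ_mem i)) hne (fun i => of fun p s => U (i, p) s)
    (fun j => of fun s q => V s (j, q)) (fun i => hblock _ _ (cycleJ_diag_mem i))
    (fun i => hblock _ _ (cycleJ_succ_mem i))
  rwa [Fintype.card_fin, Fintype.card_fin, hr] at this

lemma two_le_pmr_cycleJ (hnz : ∀ p ∈ CycleJ n, a p.1 p.2 ≠ 0)
    (hne : ∏ i : Fin n, a i (i + 1) ≠ ∏ i : Fin n, a i i) : 2 ≤ pmr (CycleJ n) a := by
  obtain ⟨B, hB, hr⟩ := exists_completes_rank_eq_pmr (CycleJ n) a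
  obtain ⟨U, V, hUV⟩ := B.exists_mul_eq_of_rank
  have hblock : ∀ i j, (i, j) ∈ CycleJ n →
      (of fun _ s => U i s : Matrix Unit _ F) * (of fun s _ => V s j) =
        a i j • (1 : Matrix Unit Unit F) := by
    intro i j hij
    ext p q
    have h1 : B i j = a i j := hB (i, j) hij
    rw [← hUV] at h1
    simpa [Matrix.mul_apply, Matrix.one_apply] using h1
  have h := card_mul_le_of_cycle_factorization a (fun i => hnz _ (cycleJ_diag_mem i))
    (fun i => hnz _ (cycleJ_succ_mem i)) hne (fun i => of fun _ s => U i s)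
    (fun j => of fun s _ => V s j) (fun i => hblock _ _ (cycleJ_diag_mem i))
    (fun i => hblock _ _ (cycleJ_succ_mem i))
  rw [Fintype.card_unit, Fintype.card_fin, hr] at h
  by_contra! hlt
  have h2 : (n - 1) * pmr (CycleJ n) a ≤ (n - 1) * 1 := Nat.mul_le_mul_left _ (by omega)
  have := NeZero.pos n
  omega

/-- Dropping one prescribed entry from the cycle leaves a pattern with a rank-one completion. -/
lemma exists_vecMulVec_completes_cycleJ_diff (hnz : ∀ p ∈ CycleJ n, a p.1 p.2 ≠ 0)
    {p : Fin n × Fin n} (hp : p ∈ CycleJ n) :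
    ∃ u v : Fin n → F, Completes (CycleJ n \ {p}) a (vecMulVec u v) := by
  have hd : ∀ i, a i i ≠ 0 := fun i => hnz _ (cycleJ_diag_mem i)
  have hs : ∀ i, a i (i + 1) ≠ 0 := fun i => hnz _ (cycleJ_succ_mem i)
  obtain ⟨k, l⟩ := p
  obtain ⟨w, hw, hw'⟩ := exists_cycle_potential (fun i => a i i) (fun i => a i (i + 1)) hd hs k
  rcases hp with hl | hl <;> dsimp only at hl <;> subst l
  · refine ⟨fun i => a i (i + 1) / w (i + 1), w, ?_⟩
    rintro ⟨i, j⟩ ⟨hj | hj, hij⟩ <;> dsimp only at hj <;> subst j <;>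
      simp only [vecMulVec_apply]
    · have hi : i ≠ k := by rintro rfl; exact hij rfl
      rw [div_mul_eq_mul_div, div_eq_iff (hw _), ← hw' i hi, mul_comm]
    · exact div_mul_cancel₀ _ (hw _)
  · refine ⟨fun i => a i i / w i, w, ?_⟩
    rintro ⟨i, j⟩ ⟨hj | hj, hij⟩ <;> dsimp only at hj <;> subst j <;>
      simp only [vecMulVec_apply]
    · exact div_mul_cancel₀ _ (hw _)
    · have hi : i ≠ k := by rintro rfl; exact hij rfl
      rw [div_mul_eq_mul_div, div_eq_iff (hw _), ← hw' i hi, mul_comm]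

lemma pmr_cycleJ_le_two (hnz : ∀ p ∈ CycleJ n, a p.1 p.2 ≠ 0) : pmr (CycleJ n) a ≤ 2 := by
  obtain ⟨u, v, huv⟩ := exists_vecMulVec_completes_cycleJ_diff hnz (cycleJ_diag_mem (0 : Fin n))
  have hB : Completes (CycleJ n) a
      (vecMulVec u v + vecMulVec (Pi.single 0 1) (Pi.single 0 (a 0 0 - u 0 * v 0))) := by
    rintro ⟨i, j⟩ hij
    by_cases h : (i, j) = (0, 0)
    · obtain ⟨rfl, rfl⟩ := Prod.mk.inj h
      simp [vecMulVec_apply]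
    · have h1 : vecMulVec u v i j = a i j := huv (i, j) ⟨hij, h⟩
      rw [Prod.mk.injEq, not_and_or] at h
      rw [Matrix.add_apply, h1, vecMulVec_apply]
      rcases h with h | h <;> simp [Pi.single_eq_of_ne h]
  calc pmr (CycleJ n) a ≤ _ := pmr_le_of_completes hB
    _ ≤ _ := Matrix.rank_add_le _ _
    _ ≤ 1 + 1 := add_le_add (Matrix.rank_vecMulVec_le _ _) (Matrix.rank_vecMulVec_le _ _)

lemma not_triangular_cycleJ (hn : 3 ≤ n) : ¬ Triangular (CycleJ n) := by
  obtain ⟨m, rfl⟩ : ∃ m, n = m + 3 := ⟨n - 3, by omega⟩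
  intro h
  have h12 : (1 : Fin (m + 3)) + 1 ≠ 0 ∧ (1 : Fin (m + 3)) ≠ 0 := by
    simp [Fin.ext_iff, Fin.val_add, Nat.mod_eq_of_lt (show 2 < m + 3 by omega)]
  rcases h _ (cycleJ_diag_mem 0) _ (cycleJ_succ_mem 1) with (h | h) | (h | h) <;>
    simp_all

lemma pmr_le_one_of_triangular (hn : 3 ≤ n) (hnz : ∀ p ∈ CycleJ n, a p.1 p.2 ≠ 0)
    {T : Set (Fin n × Fin n)} (hT : T ⊆ CycleJ n) (htri : Triangular T) : pmr T a ≤ 1 := by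
  obtain ⟨p, hp, hpT⟩ : ∃ p ∈ CycleJ n, p ∉ T := by
    by_contra! h
    exact not_triangular_cycleJ hn (hT.antisymm h ▸ htri)
  obtain ⟨u, v, huv⟩ := exists_vecMulVec_completes_cycleJ_diff hnz hp
  refine (pmr_le_of_completes fun q hq => huv q ⟨hT hq, ?_⟩).trans
    (Matrix.rank_vecMulVec_le u v)
  rintro rfl
  exact hpT hq

lemma ptmr_cycleJ (hn : 3 ≤ n) (hnz : ∀ p ∈ CycleJ n, a p.1 p.2 ≠ 0) :
    ptmr (CycleJ n) a = 1 := by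
  refine IsGreatest.csSup_eq ⟨⟨{(0, 0)}, ?_, ?_, ?_⟩, ?_⟩
  · simpa using cycleJ_diag_mem (0 : Fin n)
  · rintro p rfl q rfl
    exact Or.inl rfl
  · refine le_antisymm (pmr_le_one_of_triangular hn hnz ?_ ?_) ?_
    · simpa using cycleJ_diag_mem (0 : Fin n)
    · rintro p rfl q rfl
      exact Or.inl rfl
    · obtain ⟨B, hB, hr⟩ := exists_completes_rank_eq_pmr ({(0, 0)} : Set (Fin n × Fin n)) a
      rw [← hr, Nat.one_le_iff_ne_zero]
      intro h0
      obtain ⟨U, V, hUV⟩ := B.exists_mul_eq_of_rank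
      have : IsEmpty (Fin B.rank) := by rw [h0]; infer_instance
      apply hnz _ (cycleJ_diag_mem 0)
      rw [← hB (0, 0) rfl, ← hUV]
      simp [Matrix.mul_apply]
  · rintro r ⟨T, hT, htri, rfl⟩
    exact pmr_le_one_of_triangular hn hnz hT htri

lemma pmrb_cycleJ_le {m : ℕ} (hm : n = m + 1) (hnz : ∀ p ∈ CycleJ n, a p.1 p.2 ≠ 0) :
    pmrb (CycleJ n) a m ≤ n := by
  have hd : ∀ i, a i i ≠ 0 := fun i => hnz _ (cycleJ_diag_mem i)
  have hs : ∀ i, a i (i + 1) ≠ 0 := fun i => hnz _ (cycleJ_succ_mem i)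
  choose w hw hw' using exists_cycle_potential (fun i => a i i) (fun i => a i (i + 1)) hd hs
  subst hm
  let L : Fin (m + 1) → Fin m → Fin (m + 1) → F := fun i k s =>
    (if s = k.castSucc then 1 else 0) - (if i = k.castSucc then 1 else 0)
  let P : Fin (m + 1) → Fin m → F := fun s l =>
    (if s = l.castSucc then 1 else 0) - (if s = Fin.last m then 1 else 0)
  have hLP : ∀ i k l, ∑ s, L i k s * P s l = if k = l then 1 else 0 := by
    intro i k l
    have hne : Fin.last m ≠ k.castSucc := (Fin.castSucc_ne_last k).symm
    simp [L, P, mul_sub, Finset.sum_sub_distrib, hne, eq_comm]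
  let U : Matrix (Fin (m + 1) × Fin m) (Fin (m + 1)) F :=
    of fun p s => a p.1 p.1 * L p.1 p.2 s / w s p.1
  let V : Matrix (Fin (m + 1)) (Fin (m + 1) × Fin m) F := of fun s q => w s q.1 * P s q.2
  have hB : Completes (TensorJ (CycleJ (m + 1)) m) (TensorA a m) (U * V) := by
    rintro ⟨⟨i, k⟩, ⟨j, l⟩⟩ hij
    have hterm : ∀ s, U (i, k) s * V s (j, l) = a i j * (L i k s * P s l) := by
      intro s
      have hw0 := hw s i
      simp only [U, V, of_apply]
      rcases hij with hj | hj <;> dsimp only at hj <;> subst j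
      · field_simp
      · by_cases hi : i = s
        · subst hi
          simp [L]
        · have := hw' s i hi
          field_simp
          linear_combination L i k s * P s l * this
    simp only [Matrix.mul_apply, hterm, ← Finset.mul_sum, hLP, TensorA]
    simp
  calc pmrb (CycleJ (m + 1)) a m ≤ _ := pmr_le_of_completes hB
    _ ≤ _ := Matrix.rank_mul_le_left _ _
    _ ≤ _ := Matrix.rank_le_card_width _
    _ = _ := Fintype.card_fin _

lemma pfmr_cycleJ (hn : 2 ≤ n) (hnz : ∀ p ∈ CycleJ n, a p.1 p.2 ≠ 0)
    (hne : ∏ i : Fin n, a i (i + 1) ≠ ∏ i : Fin n, a i i) :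
    pfmr (CycleJ n) a = (n : ℝ) / ((n : ℝ) - 1) := by
  have hn' : ((n - 1 : ℕ) : ℝ) = (n : ℝ) - 1 := by
    rw [Nat.cast_sub (by omega), Nat.cast_one]
  have hpos : (0 : ℝ) < (n : ℝ) - 1 := by
    rw [← hn', Nat.cast_pos]
    omega
  refine le_antisymm ?_ (le_ciInf fun b => ?_)
  · have hbdd : BddBelow (Set.range fun b : ℕ+ => (pmrb (CycleJ n) a b : ℝ) / (b : ℝ)) :=
      ⟨0, by rintro _ ⟨b, rfl⟩; positivity⟩
    refine (ciInf_le hbdd ⟨n - 1, by omega⟩).trans ?_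
    rw [PNat.mk_coe, hn']
    gcongr
    exact pmrb_cycleJ_le (by omega) hnz
  · have hb : (0 : ℝ) < (b : ℝ) := by exact_mod_cast b.pos
    rw [div_le_div_iff₀ hpos hb, ← hn', mul_comm (_ : ℝ) ((n - 1 : ℕ) : ℝ)]
    exact_mod_cast mul_le_pmrb_cycleJ hnz hne b

end Cycle

/-- For the `n × n` cycle pattern (`n ≥ 3`) with all
prescribed entries nonzero and
`a₁₂ a₂₃ ⋯ a_{n−1,n} a_{n1} ≠ a₁₁ a₂₂ ⋯ a_{nn}`, one has
`tmr = 1`, `fmr = n/(n−1)`, and `mr = 2`. -/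
theorem stmt17 {F : Type*} [Field F] (n : ℕ) [NeZero n] (hn : 3 ≤ n)
    (a : Fin n → Fin n → F)
    (hnz : ∀ p ∈ CycleJ n, a p.1 p.2 ≠ 0)
    (hne : ∏ i : Fin n, a i (i + 1) ≠ ∏ i : Fin n, a i i) :
    ptmr (CycleJ n) a = 1 ∧
      pfmr (CycleJ n) a = (n : ℝ) / ((n : ℝ) - 1) ∧
      pmr (CycleJ n) a = 2 :=
  ⟨ptmr_cycleJ hn hnz, pfmr_cycleJ (by omega) hnz hne,
    le_antisymm (pmr_cycleJ_le_two hnz) (two_le_pmr_cycleJ hnz hne)⟩
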